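/- arXiv:2502.06577 — 5 statements merged into one kernel-verified Lean document; each statement's English description precedes it below -/
import Mathlib

section
/- Let G = (V, E) be a finite DAG and Y ∈ V a target node. For nodes X, W ∈ V, if X is superior to W relative to Y (X ≽_Y W), then every path from W to Y in G contains X. -/
open scoped Classical

/-! ## Directed graphs, paths, ancestors -/

/-- A directed graph (given by its edge relation) is acyclic if no node is
reachable from itself by a non-trivial directed walk. -/
def Acyclic {V : Type} (E : V → V → Prop) : Prop :=
  ∀ v : V, ¬ Relation.TransGen E v v

/-- `IsPath E a b p` : the list `p` is a directed path from `a` to `b` in the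
graph with edge relation `E` (a path is a nonempty list of nodes in which each
node has an edge to the next; a single-node path is trivial). -/
def IsPath {V : Type} (E : V → V → Prop) (a b : V) (p : List V) : Prop :=
  p.Chain' E ∧ p.head? = some a ∧ p.getLast? = some b

/-- Descendants of `v` (every node is a descendant of itself). -/
def De {V : Type} (E : V → V → Prop) (v : V) : Set V :=
  {u | Relation.ReflTransGen E v u}

/-- Ancestors of `v` (every node is an ancestor of itself). -/
def An {V : Type} (E : V → V → Prop) (v : V) : Set V :=
  {u | Relation.ReflTransGen E u v}

/-- Parents of `v`. -/
def Pa {V : Type} (E : V → V → Prop) (v : V) : Set V :=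
  {p | E p v}

/-! ## Strict common ancestors, LSCAs, and the LSCA closure -/

/-- `v` is a strict common ancestor of `x` and `y` : there is a path from `v`
to `x` not containing `y`, and a path from `v` to `y` not containing `x`. -/
def SCA {V : Type} (E : V → V → Prop) (x y : V) : Set V :=
  {v | (∃ p, IsPath E v x p ∧ y ∉ p) ∧ (∃ p, IsPath E v y p ∧ x ∉ p)}

/-- `v` is a lowest strict common ancestor of `x` and `y` : it is a strict
common ancestor, and no strict common ancestor of `x,y` other than `v` is a
descendant of `v`. -/
def LSCApair {V : Type} (E : V → V → Prop) (x y : V) : Set V :=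
  {v | v ∈ SCA E x y ∧ ∀ w ∈ SCA E x y, w ≠ v → w ∉ De E v}

/-- The lowest strict common ancestors of a set `U` : nodes outside `U` that
are a lowest strict common ancestor of some pair of nodes of `U`. -/
def LSCAset {V : Type} (E : V → V → Prop) (U : Set V) : Set V :=
  {v | v ∉ U ∧ ∃ u ∈ U, ∃ u' ∈ U, v ∈ LSCApair E u u'}

/-- The `i`-th order LSCA set of `U`. -/
def lscaIter {V : Type} (E : V → V → Prop) (U : Set V) : ℕ → Set V
  | 0 => U
  | k + 1 => LSCAset E (lscaIter E U k) ∪ lscaIter E U k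

/-- The LSCA closure `L∞(U)` of `U`.  (The sets `lscaIter E U i` are increasing
in `i`, so on a finite node type this union equals `lscaIter E U k` for the
least `k` with `lscaIter E U k = lscaIter E U (k+1)`.) -/
def lscaClosure {V : Type} (E : V → V → Prop) (U : Set V) : Set V :=
  ⋃ k : ℕ, lscaIter E U k

/-! ## Λ-structures -/

/-- `(v, pa, pb)` is a Λ-structure over `(a, b)` : `pa` is a path from `v` to
`a`, `pb` is a path from `v` to `b`, and the two paths intersect only at `v`
(trivial paths are allowed). -/
def IsLambdaStruct {V : Type} (E : V → V → Prop) (v a b : V) (pa pb : List V) : Prop :=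
  IsPath E v a pa ∧ IsPath E v b pb ∧ ∀ w ∈ pa, w ∈ pb → w = v

/-- `Λ(U, W)` : the set of nodes forming a Λ-structure over `(U, W)`. -/
def LambdaSet {V : Type} (E : V → V → Prop) (U W : Set V) : Set V :=
  {v | ∃ u ∈ U, ∃ w ∈ W, ∃ pa pb : List V, IsLambdaStruct E v u w pa pb}

/-! ## Structural causal models -/

/-- A structural causal model over the graph with node type `V` and edge
relation `E` : each node `v` has a nonempty finite range `R v`, a nonempty
finite noise range `N v`, and a structural assignment `f v` computing the value
of `v` from the values of its parents and its noise value. -/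
structure SCM (V : Type) (E : V → V → Prop) where
  R : V → Type
  rFin : ∀ v, Finite (R v)
  rNe : ∀ v, Nonempty (R v)
  N : V → Type
  nFin : ∀ v, Finite (N v)
  nNe : ∀ v, Nonempty (N v)
  f : ∀ v : V, (∀ p : {p // E p v}, R p.1) → N v → R v

/-- Fuel-bounded approximation to the unrolled assignment. -/
noncomputable def approx {V : Type} {E : V → V → Prop} (scm : SCM V E)
    (n : ∀ v, scm.N v) : ℕ → ∀ v, scm.R v
  | 0 => fun v => (scm.rNe v).some
  | k + 1 => fun v => scm.f v (fun p => approx scm n k p.1) (n v)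

/-- The unrolled assignment `f̄_v(n)` of an SCM over an acyclic graph: the value
of `v` obtained by recursively composing the structural assignments of the
ancestors of `v`, evaluated at the unit `n`.  (On an acyclic graph every
directed path has fewer than `card V + 1` nodes, so this fuel value computes
the exact fixed point of the unrolling recursion
`f̄_v(n) = f_v((f̄_p(n))_{p ∈ Pa(v)}, n_v)`.) -/
noncomputable def unroll {V : Type} [Fintype V] {E : V → V → Prop} (scm : SCM V E)
    (n : ∀ v, scm.N v) (v : V) : scm.R v :=
  approx scm n (Fintype.card V + 1) v

/-- The atomic intervention `do(X = x)` : replace the structural assignment of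
`X` by the constant function with value `x`. -/
noncomputable def SCM.intervene {V : Type} {E : V → V → Prop} (scm : SCM V E)
    (X : V) (x : scm.R X) : SCM V E where
  R := scm.R
  rFin := scm.rFin
  rNe := scm.rNe
  N := scm.N
  nFin := scm.nFin
  nNe := scm.nNe
  f := fun v => if h : v = X then fun _ _ => h.symm ▸ x else scm.f v

/-- Fuel-bounded approximation to the blocked unrolled assignment. -/
noncomputable def blockApprox {V : Type} [Fintype V] {E : V → V → Prop} (scm : SCM V E)
    (B : V) (b : scm.R B) (n : ∀ v, scm.N v) : ℕ → ∀ v, scm.R v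
  | 0 => fun v =>
      if h : v = B then h.symm ▸ b
      else if Relation.ReflTransGen E B v then (scm.rNe v).some
      else unroll scm n v
  | k + 1 => fun v =>
      if h : v = B then h.symm ▸ b
      else if Relation.ReflTransGen E B v then
        scm.f v (fun p => blockApprox scm B b n k p.1) (n v)
      else unroll scm n v

/-- The blocked unrolled assignment `f̄_v[B](b, n)` : equal to `b` at `v = B`,
to the plain unrolled assignment `f̄_v(n)` if `v` is not a descendant of `B`,
and otherwise obtained by the unrolling recursion
`f̄_v[B](b,n) = f_v((f̄_p[B](b,n))_{p ∈ Pa(v)}, n_v)`. -/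
noncomputable def blockUnroll {V : Type} [Fintype V] {E : V → V → Prop} (scm : SCM V E)
    (B : V) (b : scm.R B) (n : ∀ v, scm.N v) (v : V) : scm.R v :=
  blockApprox scm B b n (Fintype.card V + 1) v

/-- The edge relation of the graph obtained after a conditional intervention on
`X` with conditioning set `A` : the parent set of `X` becomes `A`, and all
other edges are unchanged. -/
def condE {V : Type} (E : V → V → Prop) (X : V) (A : Set V) : V → V → Prop :=
  fun a b => (b = X ∧ a ∈ A) ∨ (b ≠ X ∧ E a b)

/-- The conditional intervention `do(X = g(A))` : replace the structural
assignment of `X` by the function that, given the values of the nodes in `A`,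
outputs `g` of those values, so that `A` becomes the parent set of `X`. -/
noncomputable def SCM.condIntervene {V : Type} {E : V → V → Prop} (scm : SCM V E)
    (X : V) (A : Set V) (g : (∀ a : A, scm.R a.1) → scm.R X) :
    SCM V (condE E X A) where
  R := scm.R
  rFin := scm.rFin
  rNe := scm.rNe
  N := scm.N
  nFin := scm.nFin
  nNe := scm.nNe
  f := fun v par nv =>
    if h : v = X then h.symm ▸ g (fun a => par ⟨a.1, Or.inl ⟨h, a.2⟩⟩)
    else scm.f v (fun p => par ⟨p.1, Or.inr ⟨h, p.2⟩⟩) nv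

/-! ## Interventional superiority -/

/-- `X` is (deterministically atomic-interventionally) superior to `W` relative
to `Y` : for every SCM over the graph in which the range of `Y` is linearly
ordered, and every unit `n`, there is `x ∈ R_X` such that for all `w ∈ R_W`,
`f̄_Y^{do(X=x)}(n) ≥ f̄_Y^{do(W=w)}(n)`. -/
def Superior {V : Type} [Fintype V] (E : V → V → Prop) (Y X W : V) : Prop :=
  ∀ (scm : SCM V E) (L : LinearOrder (scm.R Y)) (n : ∀ v, scm.N v),
    ∃ x : scm.R X, ∀ w : scm.R W,
      L.le (unroll (scm.intervene W w) n Y) (unroll (scm.intervene X x) n Y)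

/-- Superiority for sets of nodes: `S ≽_Y T` iff every node of `T` is inferior
to some node of `S`. -/
def SetSuperior {V : Type} [Fintype V] (E : V → V → Prop) (Y : V) (S T : Set V) : Prop :=
  ∀ W ∈ T, ∃ X ∈ S, Superior E Y X W

/-- A globally interventionally superior set (GISS) of the graph relative to
`Y` : a subset `U` of `V \ {Y}` with `U ≽_Y (V \ {Y}) \ U`. -/
def IsGISS {V : Type} [Fintype V] (E : V → V → Prop) (Y : V) (U : Set V) : Prop :=
  U ⊆ Set.univ \ {Y} ∧ SetSuperior E Y U ((Set.univ \ {Y}) \ U)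

/-- A minimal globally interventionally superior set (mGISS): a GISS that is
minimal with respect to set inclusion. -/
def IsMGISS {V : Type} [Fintype V] (E : V → V → Prop) (Y : V) (U : Set V) : Prop :=
  IsGISS E Y U ∧ ∀ U' : Set V, IsGISS E Y U' → U' ⊆ U → U' = U

/-! ## The signal-forwarding model -/

/-- The value every node takes at fuel zero in a Boolean model. -/
noncomputable def boolDefault : Bool := (⟨true⟩ : Nonempty Bool).some

/-- The Boolean model in which a node of `S` takes a non-default value exactly when one of its
parents in `S` does, and every other node takes the default value. -/
noncomputable def signalSCM {V : Type} (E : V → V → Prop) (S : Set V) : SCM V E where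
  R := fun _ => Bool
  rFin := fun _ => inferInstance
  rNe := fun _ => ⟨true⟩
  N := fun _ => Unit
  nFin := fun _ => inferInstance
  nNe := fun _ => ⟨()⟩
  f := fun v par _ =>
    if v ∈ S ∧ ∃ u : {u // E u v}, u.1 ∈ S ∧ par u = !boolDefault then !boolDefault
    else boolDefault

theorem approx_intervene_self {V : Type} {E : V → V → Prop} (scm : SCM V E) (X : V) (x : scm.R X)
    (n : ∀ v, scm.N v) (k : ℕ) : approx (scm.intervene X x) n (k + 1) X = x := by
  simp [approx, SCM.intervene]

theorem signalSCM_approx_intervene_of_notMem {V : Type} (E : V → V → Prop) {S : Set V} {X : V}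
    (hX : X ∉ S) (x : Bool) (n : V → Unit) (k : ℕ) :
    ∀ v ∈ S, approx ((signalSCM E S).intervene X x) n k v = boolDefault := by
  induction k with
  | zero => exact fun v _ => rfl
  | succ k ih =>
    intro v hv
    have hne : v ≠ X := fun h => hX (h ▸ hv)
    simp only [approx, SCM.intervene, dif_neg hne]
    refine if_neg ?_
    rintro ⟨-, u, hu, h⟩
    exact Bool.not_ne_self boolDefault (h.symm.trans (ih u.1 hu))

theorem signalSCM_approx_intervene_getElem {V : Type} (E : V → V → Prop) {W : V} {p : List V}
    (hp : p.IsChain E) (hW : p.head? = some W) (n : V → Unit) (i : ℕ) (hi : i < p.length) :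
    ∀ k, i < k → approx ((signalSCM E {v | v ∈ p}).intervene W (!boolDefault)) n k p[i]
      = !boolDefault := by
  induction i with
  | zero =>
    intro k hk
    obtain ⟨k, rfl⟩ := Nat.exists_eq_succ_of_ne_zero hk.ne'
    have h0 : p[0] = W := by
      rw [List.head?_eq_getElem?, List.getElem?_eq_getElem hi] at hW
      exact Option.some.inj hW
    rw [h0]
    exact approx_intervene_self ..
  | succ i ih =>
    intro k hk
    obtain ⟨k, rfl⟩ := Nat.exists_eq_succ_of_ne_zero (Nat.ne_zero_of_lt hk)
    by_cases h : p[i + 1] = W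
    · rw [h]
      exact approx_intervene_self ..
    · simp only [approx, SCM.intervene, dif_neg h]
      exact if_pos ⟨List.getElem_mem hi, ⟨p[i], List.isChain_iff_getElem.mp hp i hi⟩,
        List.getElem_mem _, ih (by omega) k (by omega)⟩

theorem Acyclic.nodup_of_isChain {V : Type} {E : V → V → Prop} (hE : Acyclic E) {p : List V}
    (hp : p.IsChain E) : p.Nodup := by
  have h : p.IsChain (Relation.TransGen E) := hp.imp fun _ _ => Relation.TransGen.single
  refine h.pairwise.imp ?_
  rintro a b hab rfl
  exact hE a hab

/-- Let `G = (V, E)` be a finite DAG and `Y ∈ V` a target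
node.  For nodes `X, W ∈ V`, if `X` is superior to `W` relative to `Y`
(`X ≽_Y W`), then every path from `W` to `Y` in `G` contains `X`. -/
theorem superior_implies_paths_through {V : Type} [Fintype V] (E : V → V → Prop)
    (hacy : Acyclic E) (Y X W : V) (hsup : Superior E Y X W) :
    ∀ p : List V, IsPath E W Y p → X ∈ p := by
  rintro p ⟨hp, hW, hY⟩
  by_contra hX
  let L : LinearOrder Bool := LinearOrder.lift' (fun b => xor b boolDefault)
    fun a b h => by simpa using h
  obtain ⟨x, hx⟩ := hsup (signalSCM E {v | v ∈ p}) L fun _ => ()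
  have hle := hx (!boolDefault)
  have hYp : Y ∈ p := List.mem_of_getLast? hY
  have hlen : p.length ≤ Fintype.card V := (hacy.nodup_of_isChain hp).length_le_card
  have h1 : unroll ((signalSCM E {v | v ∈ p}).intervene X x) (fun _ => ()) Y = boolDefault :=
    signalSCM_approx_intervene_of_notMem E hX x _ _ Y hYp
  have h2 : unroll ((signalSCM E {v | v ∈ p}).intervene W (!boolDefault)) (fun _ => ()) Y
      = !boolDefault := by
    obtain ⟨i, hi, rfl⟩ := List.getElem_of_mem hYp
    exact signalSCM_approx_intervene_getElem E hp hW _ i hi _ (by omega)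
  have hle' : L.le (!boolDefault) boolDefault := by
    rw [h1, h2] at hle
    exact hle
  have h3 : xor (!boolDefault) boolDefault ≤ xor boolDefault boolDefault := hle'
  revert h3
  cases boolDefault <;> decide
end

section
/- Let G = (V, E) be a finite DAG and Y ∈ V a target node. The superiority relation ≽_Y on nodes of G is a preorder: it is reflexive (X ≽_Y X for every X ∈ V) and transitive (if Z ≽_Y W and W ≽_Y X then Z ≽_Y X). Moreover, the induced superiority relation on sets of nodes is also a preorder: 𝐗 ≽_Y 𝐗 for every 𝐗 ⊆ V, and if 𝐙 ≽_Y 𝐖 and 𝐖 ≽_Y 𝐗 then 𝐙 ≽_Y 𝐗. -/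
open scoped Classical

/-- Let `G = (V, E)` be a finite DAG and `Y ∈ V` a target
node.  The superiority relation `≽_Y` on nodes of `G` is a preorder (reflexive
and transitive), and the induced superiority relation on sets of nodes is also
a preorder. -/
theorem superior_is_preorder {V : Type} [Fintype V] (E : V → V → Prop)
    (hacy : Acyclic E) (Y : V) :
    (∀ X : V, Superior E Y X X) ∧
    (∀ X W Z : V, Superior E Y Z W → Superior E Y W X → Superior E Y Z X) ∧
    (∀ SX : Set V, SetSuperior E Y SX SX) ∧
    (∀ SX SW SZ : Set V, SetSuperior E Y SZ SW → SetSuperior E Y SW SX →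
      SetSuperior E Y SZ SX) := by
  have hrefl : ∀ X : V, Superior E Y X X := by
    intro X scm L n
    have := scm.rFin X
    have := scm.rNe X
    exact @Finite.exists_max _ (scm.R Y) _ _ L
      (fun x => unroll (scm.intervene X x) n Y)
  have htrans : ∀ X W Z : V, Superior E Y Z W → Superior E Y W X → Superior E Y Z X := by
    intro X W Z hZW hWX scm L n
    obtain ⟨w, hw⟩ := hWX scm L n
    obtain ⟨z, hz⟩ := hZW scm L n
    exact ⟨z, fun x => L.le_trans _ _ _ (hw x) (hz w)⟩
  refine ⟨hrefl, htrans, fun SX X hX => ⟨X, hX, hrefl X⟩, ?_⟩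
  intro SX SW SZ hZW hWX X hX
  obtain ⟨W, hW, hWX⟩ := hWX X hX
  obtain ⟨Z, hZ, hZW⟩ := hZW W hW
  exact ⟨Z, hZ, htrans X W Z hZW hWX⟩
end

section
/- Let G = (V, E) be a finite DAG and Y ∈ V a target node. If 𝐀 ⊆ V \ {Y} is a minimal globally interventionally superior set of G relative to Y, then no two distinct elements of 𝐀 are comparable under superiority: for all X, X' ∈ 𝐀 with X ≠ X', it is not the case that X' ≽_Y X. -/
open scoped Classical

/-- Superiority relative to `Y` is transitive. -/
theorem Superior.trans {V : Type} [Fintype V] {E : V → V → Prop} {Y A B C : V}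
    (hAB : Superior E Y A B) (hBC : Superior E Y B C) : Superior E Y A C := by
  intro scm L n
  obtain ⟨b, hb⟩ := hBC scm L n
  obtain ⟨a, ha⟩ := hAB scm L n
  exact ⟨a, fun c => L.le_trans _ _ _ (hb c) (ha b)⟩

/-- Removing from a globally interventionally superior set an element that is inferior to
another element leaves a globally interventionally superior set. -/
theorem IsGISS.diff_singleton {V : Type} [Fintype V] {E : V → V → Prop} {Y X X' : V}
    {U : Set V} (hU : IsGISS E Y U) (hX' : X' ∈ U) (hne : X ≠ X')
    (h : Superior E Y X' X) : IsGISS E Y (U \ {X}) := by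
  refine ⟨Set.sdiff_subset.trans hU.1, fun W hW => ?_⟩
  have hX'U : X' ∈ U \ {X} := ⟨hX', hne.symm⟩
  by_cases hWX : W = X
  · exact ⟨X', hX'U, hWX ▸ h⟩
  · obtain ⟨Z, hZ, hZW⟩ := hU.2 W ⟨hW.1, fun hWU => hW.2 ⟨hWU, hWX⟩⟩
    by_cases hZX : Z = X
    · exact ⟨X', hX'U, h.trans (hZX ▸ hZW)⟩
    · exact ⟨Z, ⟨hZ, hZX⟩, hZW⟩

/-- Let `G = (V, E)` be a finite DAG and `Y ∈ V` a target
node.  If `SA ⊆ V \ {Y}` is a minimal globally interventionally superior set of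
`G` relative to `Y`, then no two distinct elements of `SA` are comparable under
superiority: for all `X, X' ∈ SA` with `X ≠ X'`, it is not the case that
`X' ≽_Y X`. -/
theorem mgiss_elements_incomparable {V : Type} [Fintype V] (E : V → V → Prop)
    (hacy : Acyclic E) (Y : V) (SA : Set V) (hA : IsMGISS E Y SA) :
    ∀ X ∈ SA, ∀ X' ∈ SA, X ≠ X' → ¬ Superior E Y X' X := by
  intro X hX X' hX' hne h
  have hEq := hA.2 _ (hA.1.diff_singleton hX' hne h) Set.sdiff_subset
  exact (hEq.ge hX).2 rfl
end

section
/- Let G = (V, E) be a finite DAG and Y ∈ V a node with at least one parent. Then the LSCA closure of the parents of Y is a globally interventionally superior set of G relative to Y: L∞(Pa(Y)) ⊆ V \ {Y} and L∞(Pa(Y)) ≽_Y (V \ {Y}) \ L∞(Pa(Y)). -/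
open scoped Classical

/-! ## Well-founded recursion along an acyclic graph -/

theorem Acyclic.wellFounded_transGen {V : Type} [Finite V] {E : V → V → Prop}
    (h : Acyclic E) : WellFounded (Relation.TransGen E) :=
  haveI : Std.Irrefl (Relation.TransGen E) := ⟨h⟩
  Finite.wellFounded_of_trans_of_irrefl _

theorem Acyclic.wellFounded_flip_transGen {V : Type} [Finite V] {E : V → V → Prop}
    (h : Acyclic E) : WellFounded (fun a b => Relation.TransGen E b a) :=
  haveI : Std.Irrefl (fun a b => Relation.TransGen E b a) := ⟨h⟩
  haveI : IsTrans V (fun a b => Relation.TransGen E b a) := ⟨fun _ _ _ h₁ h₂ => h₂.trans h₁⟩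
  Finite.wellFounded_of_trans_of_irrefl _

/-- The number of strict ancestors increases along edges. -/
theorem Acyclic.ncard_strictAncestors_lt {V : Type} [Finite V] {E : V → V → Prop}
    (h : Acyclic E) {p v : V} (hpv : E p v) :
    {u | Relation.TransGen E u p}.ncard < {u | Relation.TransGen E u v}.ncard := by
  refine Set.ncard_lt_ncard ⟨fun u hu => Relation.TransGen.tail hu hpv, fun hsub => ?_⟩
  exact h p (hsub (Relation.TransGen.single hpv))

theorem approx_succ_eq {V : Type} [Finite V] {E : V → V → Prop} (hacy : Acyclic E)
    (scm : SCM V E) (n : ∀ v, scm.N v) (k : ℕ) :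
    ∀ v, {u | Relation.TransGen E u v}.ncard < k →
      approx scm n (k + 1) v = approx scm n k v := by
  induction k with
  | zero => intro v hv; omega
  | succ k ih =>
    intro v hv
    change scm.f v _ (n v) = scm.f v _ (n v)
    congr 1
    funext p
    exact ih p.1 (by have := hacy.ncard_strictAncestors_lt p.2; omega)

/-- The unrolled assignment satisfies its defining recursion. -/
theorem unroll_eq {V : Type} [Fintype V] {E : V → V → Prop} (hacy : Acyclic E)
    (scm : SCM V E) (n : ∀ v, scm.N v) (v : V) :
    unroll scm n v = scm.f v (fun p => unroll scm n p.1) (n v) := by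
  change scm.f v _ (n v) = scm.f v _ (n v)
  congr 1
  funext p
  refine (approx_succ_eq hacy scm n _ p.1 ?_).symm
  have h₁ := hacy.ncard_strictAncestors_lt p.2
  have h₂ : {u | Relation.TransGen E u v}.ncard ≤ Fintype.card V := by
    rw [← Nat.card_eq_fintype_card]
    exact Set.ncard_le_card _
  omega

theorem unroll_intervene_self {V : Type} [Fintype V] {E : V → V → Prop} (hacy : Acyclic E)
    (scm : SCM V E) (n : ∀ v, scm.N v) (X : V) (x : scm.R X) :
    unroll (scm.intervene X x) n X = x := by
  refine (unroll_eq hacy (scm.intervene X x) n X).trans ?_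
  simp [SCM.intervene]

theorem unroll_intervene_of_ne {V : Type} [Fintype V] {E : V → V → Prop} (hacy : Acyclic E)
    (scm : SCM V E) (n : ∀ v, scm.N v) {X v : V} (x : scm.R X) (hv : v ≠ X) :
    unroll (scm.intervene X x) n v =
      scm.f v (fun p => unroll (scm.intervene X x) n p.1) (n v) := by
  refine (unroll_eq hacy (scm.intervene X x) n v).trans ?_
  simp [SCM.intervene, hv]

/-- If every path from `W` to `v` meets `X`, then the effect on `v` of an intervention on `W`
is reproduced by an intervention on `X`. -/
theorem unroll_intervene_eq_of_separates {V : Type} [Fintype V] {E : V → V → Prop}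
    (hacy : Acyclic E) (scm : SCM V E) (n : ∀ v, scm.N v) {X W : V} (w : scm.R W) (v : V)
    (hv : ¬ Relation.ReflTransGen (fun a b => E a b ∧ b ≠ X) W v) :
    unroll (scm.intervene X (unroll (scm.intervene W w) n X)) n v =
      unroll (scm.intervene W w) n v := by
  induction v using hacy.wellFounded_transGen.induction with
  | h v ih =>
    by_cases hvX : v = X
    · subst hvX
      exact unroll_intervene_self hacy _ _ _ _
    · have hvW : v ≠ W := by
        rintro rfl
        exact hv .refl
      refine (unroll_intervene_of_ne hacy scm n _ hvX).trans
        (Eq.trans ?_ (unroll_intervene_of_ne hacy scm n w hvW).symm)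
      exact congrArg (fun q => scm.f v q (n v)) <| funext fun p =>
        ih p.1 (.single p.2) fun hp => hv (hp.tail ⟨p.2, hvX⟩)

theorem superior_of_separates {V : Type} [Fintype V] {E : V → V → Prop} (hacy : Acyclic E)
    {X W Y : V} (hY : ¬ Relation.ReflTransGen (fun a b => E a b ∧ b ≠ X) W Y) :
    Superior E Y X W := by
  intro scm L n
  have := scm.rFin W
  have := scm.rNe W
  let _ : LinearOrder (scm.R Y) := L
  obtain ⟨w, hw⟩ := Finite.exists_max
    (fun w : scm.R W => (unroll (scm.intervene W w) n Y : scm.R Y))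
  refine ⟨unroll (scm.intervene W w) n X, fun w' => ?_⟩
  exact (hw w').trans_eq (unroll_intervene_eq_of_separates hacy scm n w Y hY).symm

/-! ## Paths and reachability -/

theorem exists_isPath_of_reflTransGen {V : Type} {E : V → V → Prop} {Q : V → Prop} {a b : V}
    (h : Relation.ReflTransGen (fun x y => E x y ∧ Q y) a b) (ha : Q a) :
    ∃ p, IsPath E a b p ∧ ∀ c ∈ p, Q c := by
  induction h using Relation.ReflTransGen.head_induction_on with
  | refl => exact ⟨[b], ⟨List.isChain_singleton _, rfl, rfl⟩, by simpa using ha⟩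
  | @head a c hac _ ih =>
    obtain ⟨p, ⟨hp₁, hp₂, hp₃⟩, hQ⟩ := ih hac.2
    cases p with
    | nil => simp at hp₂
    | cons d p =>
      obtain rfl : d = c := by simpa using hp₂
      refine ⟨a :: d :: p, ⟨List.isChain_cons_cons.2 ⟨hac.1, hp₁⟩, rfl, ?_⟩, ?_⟩
      · simpa using hp₃
      · intro e he
        rcases List.mem_cons.1 he with rfl | he
        · exact ha
        · exact hQ e he

theorem IsPath.reflTransGen {V : Type} {E : V → V → Prop} {a b : V} {p : List V}
    (h : IsPath E a b p) : Relation.ReflTransGen E a b := by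
  induction p generalizing a with
  | nil => simp [IsPath] at h
  | cons d p ih =>
    obtain ⟨h₁, h₂, h₃⟩ := h
    obtain rfl : d = a := by simpa using h₂
    cases p with
    | nil =>
      obtain rfl : d = b := by simpa using h₃
      exact .refl
    | cons c p =>
      have hc := List.isChain_cons_cons.1 h₁
      exact .head hc.1 (ih ⟨hc.2, rfl, by simpa using h₃⟩)

theorem IsPath.mem_head {V : Type} {E : V → V → Prop} {a b : V} {p : List V}
    (h : IsPath E a b p) : a ∈ p :=
  List.mem_of_head? h.2.1

/-- A strict common ancestor is a strict ancestor. -/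
theorem transGen_of_mem_SCA {V : Type} {E : V → V → Prop} {x y v : V} (h : v ∈ SCA E x y) :
    Relation.TransGen E v x := by
  obtain ⟨⟨p, hp, -⟩, ⟨q, hq, hxq⟩⟩ := h
  rcases Relation.reflTransGen_iff_eq_or_transGen.1 hp.reflTransGen with rfl | h
  · exact absurd hq.mem_head hxq
  · exact h

/-- Every strict common ancestor has a lowest strict common ancestor among its descendants. -/
theorem exists_LSCApair_of_mem_SCA {V : Type} [Finite V] {E : V → V → Prop} (hacy : Acyclic E)
    {x y v : V} (h : v ∈ SCA E x y) :
    ∃ w ∈ LSCApair E x y, Relation.ReflTransGen E v w := by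
  obtain ⟨w, ⟨hw, hvw⟩, hmin⟩ := hacy.wellFounded_flip_transGen.has_min
    {w | w ∈ SCA E x y ∧ Relation.ReflTransGen E v w} ⟨v, h, .refl⟩
  refine ⟨w, ⟨hw, fun u hu hne hwu => ?_⟩, hvw⟩
  rcases Relation.reflTransGen_iff_eq_or_transGen.1 hwu with rfl | ht
  · exact hne rfl
  · exact hmin u ⟨hu, hvw.trans hwu⟩ ht

/-! ## The LSCA closure -/

theorem lscaIter_mono {V : Type} (E : V → V → Prop) (U : Set V) : Monotone (lscaIter E U) :=
  monotone_nat_of_le_succ fun _ => Set.subset_union_right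

theorem subset_lscaClosure {V : Type} (E : V → V → Prop) (U : Set V) : U ⊆ lscaClosure E U :=
  fun _ hu => Set.mem_iUnion.2 ⟨0, hu⟩

theorem mem_lscaClosure_of_mem_LSCApair {V : Type} {E : V → V → Prop} {U : Set V} {x y v : V}
    (hx : x ∈ lscaClosure E U) (hy : y ∈ lscaClosure E U) (hv : v ∈ LSCApair E x y) :
    v ∈ lscaClosure E U := by
  obtain ⟨i, hi⟩ := Set.mem_iUnion.1 hx
  obtain ⟨j, hj⟩ := Set.mem_iUnion.1 hy
  refine Set.mem_iUnion.2 ⟨max i j + 1, ?_⟩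
  by_cases hmem : v ∈ lscaIter E U (max i j)
  · exact Or.inr hmem
  · exact Or.inl ⟨hmem, x, lscaIter_mono E U (le_max_left i j) hi, y,
      lscaIter_mono E U (le_max_right i j) hj, hv⟩

theorem transGen_of_mem_lscaClosure_Pa {V : Type} {E : V → V → Prop} {Y v : V}
    (hv : v ∈ lscaClosure E (Pa E Y)) : Relation.TransGen E v Y := by
  obtain ⟨k, hk⟩ := Set.mem_iUnion.1 hv
  induction k generalizing v with
  | zero => exact .single hk
  | succ k ih =>
    rcases hk with ⟨-, u, hu, u', -, hv'⟩ | hk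
    · exact (transGen_of_mem_SCA hv'.1).trans (ih (Set.mem_iUnion.2 ⟨k, hu⟩) hu)
    · exact ih hv hk

/-- The nodes of `C` that are reached from `W` by a path all of whose nodes strictly between
`W` and the endpoint lie outside `C`. -/
def firstHits {V : Type} (E : V → V → Prop) (C : Set V) (W : V) : Set V :=
  {c | c ∈ C ∧ ∃ u, Relation.ReflTransGen (fun a b => E a b ∧ b ∉ C) W u ∧ E u c}

/-- A path from `W ∉ C` to a node of `C` passes through a first hit. -/
theorem exists_firstHit {V : Type} {E : V → V → Prop} {C : Set V} {Q : V → Prop} {W v : V}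
    (h : Relation.ReflTransGen (fun a b => E a b ∧ Q b) W v) (hW : W ∉ C) (hv : v ∈ C) :
    ∃ c ∈ firstHits E C W, Q c ∧ Relation.ReflTransGen E c v := by
  suffices H : (v ∉ C ∧ Relation.ReflTransGen (fun a b => E a b ∧ b ∉ C) W v) ∨
      ∃ c ∈ firstHits E C W, Q c ∧ Relation.ReflTransGen E c v from
    H.resolve_left fun h' => h'.1 hv
  clear hv
  induction h with
  | refl => exact Or.inl ⟨hW, .refl⟩
  | @tail b c _ hbc ih =>
    rcases ih with ⟨-, hb⟩ | ⟨d, hd, hQ, hdb⟩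
    · by_cases hc : c ∈ C
      · exact Or.inr ⟨c, ⟨hc, b, hb, hbc.1⟩, hbc.2, .refl⟩
      · exact Or.inl ⟨hc, hb.tail ⟨hbc.1, hc⟩⟩
    · exact Or.inr ⟨d, hd, hQ, hdb.tail hbc.1⟩

theorem exists_isPath_of_mem_firstHits {V : Type} {E : V → V → Prop} {C : Set V} {W c d : V}
    (hW : W ∉ C) (hc : c ∈ firstHits E C W) (hd : d ∈ C) (hcd : c ≠ d) :
    ∃ p, IsPath E W c p ∧ d ∉ p := by
  obtain ⟨-, u, hu, huc⟩ := hc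
  have h : Relation.ReflTransGen (fun a b => E a b ∧ b ≠ d) W c :=
    .tail (Relation.ReflTransGen.mono (fun a b hab => ⟨hab.1, fun h => hab.2 (h ▸ hd)⟩) _ _ hu)
      ⟨huc, hcd⟩
  obtain ⟨p, hp, hQ⟩ := exists_isPath_of_reflTransGen h fun h => hW (h ▸ hd)
  exact ⟨p, hp, fun hdp => hQ d hdp rfl⟩

/-- A node outside the LSCA closure has at most one first hit in the closure. -/
theorem subsingleton_firstHits_lscaClosure {V : Type} [Finite V] {E : V → V → Prop}
    (hacy : Acyclic E) {U : Set V} {W : V} (hW : W ∉ lscaClosure E U) :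
    (firstHits E (lscaClosure E U) W).Subsingleton := by
  rcases (firstHits E (lscaClosure E U) W).eq_empty_or_nonempty with h | h
  · rw [h]
    exact Set.subsingleton_empty
  obtain ⟨c, hc, hmin⟩ := hacy.wellFounded_transGen.has_min _ h
  suffices H : ∀ d ∈ firstHits E (lscaClosure E U) W, d = c from
    fun a ha b hb => (H a ha).trans (H b hb).symm
  intro d hd
  by_contra hne
  have hSCA : W ∈ SCA E c d :=
    ⟨exists_isPath_of_mem_firstHits hW hc hd.1 (Ne.symm hne),
      exists_isPath_of_mem_firstHits hW hd hc.1 hne⟩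
  obtain ⟨w, hw, hWw⟩ := exists_LSCApair_of_mem_SCA hacy hSCA
  obtain ⟨e, he, -, hew⟩ := exists_firstHit (Q := fun _ => True)
    (Relation.ReflTransGen.mono (fun a b hab => ⟨hab, trivial⟩) _ _ hWw) hW
    (mem_lscaClosure_of_mem_LSCApair hc.1 hd.1 hw)
  exact hmin e he (.trans_right hew (transGen_of_mem_SCA hw.1))

/-- Let `G = (V, E)` be a finite DAG and `Y ∈ V` a node with
at least one parent.  Then the LSCA closure of the parents of `Y` is a globally
interventionally superior set of `G` relative to `Y`:
`L∞(Pa(Y)) ⊆ V \ {Y}` and `L∞(Pa(Y)) ≽_Y (V \ {Y}) \ L∞(Pa(Y))`. -/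
theorem lscaClosure_parents_is_giss {V : Type} [Fintype V] (E : V → V → Prop)
    (hacy : Acyclic E) (Y : V) (hpa : (Pa E Y).Nonempty) :
    lscaClosure E (Pa E Y) ⊆ Set.univ \ {Y} ∧
    SetSuperior E Y (lscaClosure E (Pa E Y))
      ((Set.univ \ {Y}) \ lscaClosure E (Pa E Y)) := by
  refine ⟨fun v hv => ⟨trivial, ?_⟩, ?_⟩
  · rintro rfl
    exact hacy v (transGen_of_mem_lscaClosure_Pa hv)
  rintro W ⟨⟨-, hWY⟩, hW⟩
  have hsep : ∀ X, (∀ c ∈ firstHits E (lscaClosure E (Pa E Y)) W, c = X) →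
      ¬ Relation.ReflTransGen (fun a b => E a b ∧ b ≠ X) W Y := by
    intro X hX h
    rcases Relation.ReflTransGen.cases_tail h with h | ⟨p, hp, hpY, -⟩
    · exact hWY h.symm
    · obtain ⟨c, hc, hne, -⟩ := exists_firstHit hp hW (subset_lscaClosure E _ hpY)
      exact hne (hX c hc)
  rcases (firstHits E (lscaClosure E (Pa E Y)) W).eq_empty_or_nonempty with h | ⟨X, hX⟩
  · obtain ⟨X, hX⟩ := hpa
    exact ⟨X, subset_lscaClosure E _ hX, superior_of_separates hacy (hsep X (by simp [h]))⟩
  · exact ⟨X, hX.1, superior_of_separates hacy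
      (hsep X fun c hc => subsingleton_firstHits_lscaClosure hacy hW hc hX)⟩
end

section
/- Let G = (V, E) be a finite DAG and Y ∈ V a node with at least one parent. For every B ∈ L∞(Pa(Y)), the set I = L∞(Pa(Y)) \ {B} is not globally interventionally superior: there is no X ∈ I with X ≽_Y B, and hence it is not the case that I ≽_Y (V \ {Y}) \ I. -/
open scoped Classical

/-- `b` is reachable from `a` along a directed path that does not contain `x`. -/
def ReachAvoiding {V : Type} (E : V → V → Prop) (x a b : V) : Prop :=
  a ≠ x ∧ Relation.ReflTransGen (fun p q => E p q ∧ q ≠ x) a b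

namespace ReachAvoiding

variable {V : Type} {E : V → V → Prop} {x y a b c : V}

theorem reflTransGen (h : ReachAvoiding E x a b) : Relation.ReflTransGen E a b :=
  Relation.ReflTransGen.mono (fun _ _ h => h.1) _ _ h.2

theorem ne_left (h : ReachAvoiding E x a b) : a ≠ x := h.1

theorem ne_right (h : ReachAvoiding E x a b) : b ≠ x := by
  rcases Relation.ReflTransGen.cases_tail h.2 with rfl | ⟨_, _, hb⟩
  · exact h.1
  · exact hb.2

theorem refl (h : a ≠ x) : ReachAvoiding E x a a := ⟨h, .refl⟩

theorem trans (hab : ReachAvoiding E x a b) (hbc : ReachAvoiding E x b c) :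
    ReachAvoiding E x a c :=
  ⟨hab.1, Relation.ReflTransGen.trans hab.2 hbc.2⟩

theorem head (ha : a ≠ x) (hab : E a b) (hbc : ReachAvoiding E x b c) :
    ReachAvoiding E x a c :=
  ⟨ha, Relation.ReflTransGen.head ⟨hab, hbc.1⟩ hbc.2⟩

theorem of_isPath {p : List V} (hp : IsPath E a b p) (hx : x ∉ p) : ReachAvoiding E x a b := by
  induction p generalizing a with
  | nil => simp [IsPath] at hp
  | cons d l ih =>
    obtain ⟨hc, hh, hl⟩ := hp
    obtain rfl : d = a := by simpa using hh
    simp only [List.mem_cons, not_or] at hx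
    cases l with
    | nil =>
      obtain rfl : d = b := by simpa using hl
      exact refl (Ne.symm hx.1)
    | cons e l =>
      have hc' := List.isChain_cons_cons.1 hc
      exact head (Ne.symm hx.1) hc'.1 (ih ⟨hc'.2, rfl, by simpa using hl⟩ hx.2)

theorem exists_isPath (h : ReachAvoiding E x a b) : ∃ p, IsPath E a b p ∧ x ∉ p := by
  obtain ⟨ha, h⟩ := h
  induction h using Relation.ReflTransGen.head_induction_on with
  | refl => exact ⟨[b], ⟨List.isChain_singleton b, rfl, rfl⟩, by simpa using ha.symm⟩
  | @head a c hac _ ih =>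
    obtain ⟨p, ⟨hc, hh, hl⟩, hx⟩ := ih hac.2
    cases p with
    | nil => simp at hh
    | cons d l =>
      obtain rfl : d = c := by simpa using hh
      refine ⟨a :: d :: l, ⟨List.isChain_cons_cons.2 ⟨hac.1, hc⟩, rfl, ?_⟩, ?_⟩
      · simpa using hl
      · simpa [ha.symm] using hx

/-- A node `y` different from `a` either can be avoided on the way from `a` to `b`, or is itself
passed by some path from `a` to `b` that does not contain `x`. -/
theorem avoid_or_pass (h : ReachAvoiding E x a b) (ha : a ≠ y) :
    ReachAvoiding E y a b ∨ (ReachAvoiding E x y b ∧ Relation.ReflTransGen E a y) := by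
  obtain ⟨-, h⟩ := h
  induction h using Relation.ReflTransGen.head_induction_on with
  | refl => exact .inl (refl ha)
  | @head a c hac hcb ih =>
    rcases eq_or_ne c y with rfl | hcy
    · exact .inr ⟨⟨hac.2, hcb⟩, .single hac.1⟩
    · rcases ih hcy with ih | ⟨h1, h2⟩
      · exact .inl (head ha hac.1 ih)
      · exact .inr ⟨h1, .head hac.1 h2⟩

end ReachAvoiding

theorem mem_SCA_iff {V : Type} {E : V → V → Prop} {x y v : V} :
    v ∈ SCA E x y ↔ ReachAvoiding E y v x ∧ ReachAvoiding E x v y :=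
  ⟨fun ⟨⟨_, h1, h2⟩, ⟨_, h3, h4⟩⟩ => ⟨.of_isPath h1 h2, .of_isPath h3 h4⟩,
    fun h => ⟨h.1.exists_isPath, h.2.exists_isPath⟩⟩

/-- Every node of the LSCA closure of the parents of `Y` is a proper ancestor of `Y`. -/
theorem transGen_of_mem_lscaClosure {V : Type} {E : V → V → Prop} {Y v : V}
    (h : v ∈ lscaClosure E (Pa E Y)) : Relation.TransGen E v Y := by
  obtain ⟨k, hk⟩ := Set.mem_iUnion.1 h
  clear h
  induction k generalizing v with
  | zero => exact .single hk
  | succ k ih =>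
    rcases hk with ⟨-, u, hu, u', -, hv, -⟩ | hk
    · exact Relation.TransGen.trans_right (mem_SCA_iff.1 hv).1.reflTransGen (ih hu)
    · exact ih hk

/-- From a node of the LSCA closure of the parents of `Y`, the node `Y` can be reached while
avoiding any other given node. -/
theorem reachAvoiding_of_mem_lscaClosure {V : Type} {E : V → V → Prop} {Y X v : V}
    (h : v ∈ lscaClosure E (Pa E Y)) (hvX : v ≠ X) (hXY : X ≠ Y) : ReachAvoiding E X v Y := by
  obtain ⟨k, hk⟩ := Set.mem_iUnion.1 h
  clear h
  induction k generalizing v with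
  | zero => exact .head hvX hk (.refl hXY.symm)
  | succ k ih =>
    rcases hk with ⟨-, u, hu, u', hu', hv, hlow⟩ | hk
    · obtain ⟨h1, h2⟩ := mem_SCA_iff.1 hv
      rcases h1.avoid_or_pass hvX with h3 | ⟨h3, hvX'⟩
      · exact h3.trans (ih h3.ne_right hu)
      rcases h2.avoid_or_pass hvX with h4 | ⟨h4, -⟩
      · exact h4.trans (ih h4.ne_right hu')
      exact absurd hvX' (hlow X (mem_SCA_iff.2 ⟨h3, h4⟩) hvX.symm)
    · exact ih hvX hk

theorem approx_intervene_of_ne {V : Type} {E : V → V → Prop} (scm : SCM V E) {X v : V}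
    (hv : v ≠ X) (x : scm.R X) (n : ∀ v, scm.N v) (k : ℕ) :
    approx (scm.intervene X x) n (k + 1) v =
      scm.f v (fun p => approx (scm.intervene X x) n k p.1) (n v) := by
  simp [approx, SCM.intervene, hv]

theorem ncard_An_lt {V : Type} [Fintype V] {E : V → V → Prop} (hacy : Acyclic E) {p v : V}
    (h : E p v) : (An E p).ncard < (An E v).ncard := by
  refine Set.ncard_lt_ncard ⟨fun u hu => Relation.ReflTransGen.tail hu h, fun hsub => ?_⟩
    (Set.toFinite _)
  exact hacy v (Relation.TransGen.tail' (hsub (.refl : Relation.ReflTransGen E v v)) h)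

/-- The Boolean SCM in which a node is `true` iff one of its parents other than `X` is. -/
noncomputable def orSCM {V : Type} (E : V → V → Prop) (X : V) : SCM V E where
  R := fun _ => Bool
  rFin := fun _ => inferInstance
  rNe := fun _ => inferInstance
  N := fun _ => Unit
  nFin := fun _ => inferInstance
  nNe := fun _ => inferInstance
  f := fun _ par _ => decide (∃ p, p.1 ≠ X ∧ par p = true)

theorem approx_orSCM_intervene_self {V : Type} [Fintype V] {E : V → V → Prop}
    (hacy : Acyclic E) (X : V) (x : Bool) (n : V → Unit) (k : ℕ) {v : V} (hv : v ≠ X)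
    (hk : (An E v).ncard ≤ k) :
    approx ((orSCM E X).intervene X x) n k v = false := by
  induction k generalizing v with
  | zero =>
    have : 0 < (An E v).ncard := (Set.ncard_pos (Set.toFinite _)).2 ⟨v, .refl⟩
    omega
  | succ k ih =>
    refine (approx_intervene_of_ne (orSCM E X) hv x n k).trans
      (@decide_eq_false _ (Classical.propDecidable _) ?_)
    rintro ⟨⟨p, hp⟩, hpX, h⟩
    have := ncard_An_lt hacy hp
    exact Bool.false_ne_true ((ih (v := p) hpX (by omega)).symm.trans h)

theorem approx_orSCM_intervene_true {V : Type} [Fintype V] {E : V → V → Prop}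
    (hacy : Acyclic E) {X B v : V} (n : V → Unit) (h : ReachAvoiding E X B v) (k : ℕ)
    (hk : (An E v).ncard ≤ k) :
    approx ((orSCM E X).intervene B true) n k v = true := by
  obtain ⟨hB, h⟩ := h
  induction h generalizing k with
  | refl =>
    have : 0 < (An E B).ncard := (Set.ncard_pos (Set.toFinite _)).2 ⟨B, .refl⟩
    obtain ⟨k, rfl⟩ := Nat.exists_eq_succ_of_ne_zero (show k ≠ 0 by omega)
    exact approx_intervene_self (orSCM E X) B true n k
  | @tail p v hBp hpv ih =>
    have hlt := ncard_An_lt hacy hpv.1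
    obtain ⟨k, rfl⟩ := Nat.exists_eq_succ_of_ne_zero (show k ≠ 0 by omega)
    rcases eq_or_ne v B with rfl | hvB
    · exact approx_intervene_self (orSCM E X) v true n k
    · exact (approx_intervene_of_ne (orSCM E X) hvB true n k).trans
        (@decide_eq_true _ (Classical.propDecidable _)
          ⟨⟨p, hpv.1⟩, ReachAvoiding.ne_right ⟨hB, hBp⟩, ih k (by omega)⟩)

theorem not_superior_of_reachAvoiding {V : Type} [Fintype V] {E : V → V → Prop}
    (hacy : Acyclic E) {Y X B : V} (h : ReachAvoiding E X B Y) : ¬ Superior E Y X B := by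
  intro hsup
  have hcard : (An E Y).ncard ≤ Fintype.card V + 1 := by
    have := Set.ncard_le_card (An E Y)
    rw [Nat.card_eq_fintype_card] at this
    omega
  obtain ⟨x, hx⟩ := hsup (orSCM E X) (inferInstanceAs (LinearOrder Bool)) (fun _ => ())
  have hle := hx true
  have h1 : unroll ((orSCM E X).intervene B true) (fun _ => ()) Y = true :=
    approx_orSCM_intervene_true hacy _ h _ hcard
  have h2 : unroll ((orSCM E X).intervene X x) (fun _ => ()) Y = false :=
    approx_orSCM_intervene_self hacy X x _ _ h.ne_right hcard
  rw [h1, h2] at hle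
  exact absurd (show true ≤ false from hle) (by decide)

/-- Let `G = (V, E)` be a finite DAG and `Y ∈ V` a node with
at least one parent.  For every `B ∈ L∞(Pa(Y))`, the set
`I = L∞(Pa(Y)) \ {B}` is not globally interventionally superior: there is no
`X ∈ I` with `X ≽_Y B`, and hence it is not the case that
`I ≽_Y (V \ {Y}) \ I`. -/
theorem lscaClosure_minus_node_not_giss {V : Type} [Fintype V] (E : V → V → Prop)
    (hacy : Acyclic E) (Y : V) (hpa : (Pa E Y).Nonempty)
    (B : V) (hB : B ∈ lscaClosure E (Pa E Y)) :
    (¬ ∃ X ∈ lscaClosure E (Pa E Y) \ {B}, Superior E Y X B) ∧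
    ¬ SetSuperior E Y (lscaClosure E (Pa E Y) \ {B})
      ((Set.univ \ {Y}) \ (lscaClosure E (Pa E Y) \ {B})) := by
  have hnot : ¬ ∃ X ∈ lscaClosure E (Pa E Y) \ {B}, Superior E Y X B := by
    rintro ⟨X, ⟨hX, hXB⟩, hsup⟩
    refine not_superior_of_reachAvoiding hacy
      (reachAvoiding_of_mem_lscaClosure hB (Ne.symm hXB) ?_) hsup
    rintro rfl
    exact hacy X (transGen_of_mem_lscaClosure hX)
  refine ⟨hnot, fun h => hnot (h B ⟨⟨trivial, ?_⟩, fun hmem => hmem.2 rfl⟩)⟩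
  rintro rfl
  exact hacy B (transGen_of_mem_lscaClosure hB)
end
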